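/- Let g be a probability density which is essentially bounded, with g(ω) ≤ C for (Lebesgue-)a.e. ω, where C > 0. Then for every λ ∈ ℂ with Re λ > 0 one has Re ∫_ℝ g(ω)/(λ − iω) dω = ∫_ℝ (Re λ)·g(ω)/((Re λ)² + (ω − Im λ)²) dω ≤ π·C. Consequently, if 0 < K < 2/(π·C), then there is no λ ∈ ℂ with Re λ > 0 satisfying ∫_ℝ g(ω)/(λ − iω) dω = 2/K. -/

import Mathlib

open MeasureTheory Filter

theorem poissonKernel_eq_scaled_inv_one_add_sq {x : ℝ} (hx : 0 < x) (y ω : ℝ) :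
    x / (x ^ 2 + (ω - y) ^ 2) = x⁻¹ * (1 + ((ω - y) / x) ^ 2)⁻¹ := by
  have h : x ^ 2 + (ω - y) ^ 2 ≠ 0 := by positivity
  have h' : 1 + ((ω - y) / x) ^ 2 ≠ 0 := by positivity
  field_simp

theorem integrable_poissonKernel {x : ℝ} (hx : 0 < x) (y : ℝ) :
    Integrable fun ω : ℝ => x / (x ^ 2 + (ω - y) ^ 2) := by
  simp_rw [poissonKernel_eq_scaled_inv_one_add_sq hx]
  exact ((integrable_inv_one_add_sq.comp_div hx.ne').comp_sub_right y).const_mul _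

theorem integral_poissonKernel {x : ℝ} (hx : 0 < x) (y : ℝ) :
    ∫ ω : ℝ, x / (x ^ 2 + (ω - y) ^ 2) = Real.pi := by
  simp_rw [poissonKernel_eq_scaled_inv_one_add_sq hx]
  rw [integral_const_mul, integral_sub_right_eq_self (fun t : ℝ => (1 + (t / x) ^ 2)⁻¹) y,
    Measure.integral_comp_div (fun t : ℝ => (1 + t ^ 2)⁻¹), integral_univ_inv_one_add_sq,
    abs_of_pos hx, smul_eq_mul, inv_mul_cancel_left₀ hx.ne']

theorem re_ofReal_div_sub_I_mul (a ω : ℝ) (z : ℂ) :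
    ((a : ℂ) / (z - Complex.I * ω)).re = z.re * a / (z.re ^ 2 + (ω - z.im) ^ 2) := by
  have h : Complex.normSq (z - Complex.I * ω) = z.re ^ 2 + (ω - z.im) ^ 2 := by
    simp [Complex.normSq_apply]
    ring
  rw [Complex.div_re, h]
  simp [mul_comm]

theorem integrable_div_sub_I_mul {g : ℝ → ℝ} (hg : Integrable g) {z : ℂ} (hz : 0 < z.re) :
    Integrable fun ω : ℝ => (g ω : ℂ) / (z - Complex.I * ω) := by
  have hmeas : AEStronglyMeasurable (fun ω : ℝ => (z - Complex.I * ω)⁻¹) :=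
    Measurable.aestronglyMeasurable (by fun_prop)
  simp_rw [div_eq_mul_inv]
  refine hg.ofReal.mul_bdd (c := z.re⁻¹) hmeas (ae_of_all _ fun ω => ?_)
  rw [norm_inv]
  refine inv_anti₀ hz ?_
  simpa using Complex.re_le_norm (z - Complex.I * ω)

/-- **Lemma 3.3(iii).** For an essentially bounded probability density `g` with
`g ≤ C` a.e. and `Re λ > 0`, the real part of `D(λ) = ∫ g(ω)/(λ − iω) dω` is
the Poisson average `∫ (Re λ)·g(ω)/((Re λ)² + (ω − Im λ)²) dω ≤ π C`.
Consequently, for `0 < K < 2/(π C)` the equation `D(λ) = 2/K` has no root in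
the right half plane. -/
theorem bounded_density_no_small_K_eigenvalues
    (g : ℝ → ℝ) (hmeas : Measurable g) (hnonneg : ∀ ω, 0 ≤ g ω)
    (hprob : ∫ ω : ℝ, g ω = 1)
    (C : ℝ) (hC : 0 < C) (hbound : ∀ᵐ ω ∂(volume : Measure ℝ), g ω ≤ C) :
    (∀ z : ℂ, 0 < z.re →
      (∫ ω : ℝ, (g ω : ℂ) / (z - Complex.I * ω)).re =
        (∫ ω : ℝ, z.re * g ω / (z.re ^ 2 + (ω - z.im) ^ 2)) ∧
      (∫ ω : ℝ, z.re * g ω / (z.re ^ 2 + (ω - z.im) ^ 2)) ≤ Real.pi * C) ∧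
    (∀ K : ℝ, 0 < K → K < 2 / (Real.pi * C) →
      ¬ ∃ z : ℂ, 0 < z.re ∧
        (∫ ω : ℝ, (g ω : ℂ) / (z - Complex.I * ω)) = 2 / (K : ℂ)) := by
  have hg : Integrable g := .of_integral_ne_zero (by simp [hprob])
  have hpoisson : ∀ z : ℂ, 0 < z.re →
      (∫ ω : ℝ, (g ω : ℂ) / (z - Complex.I * ω)).re =
        (∫ ω : ℝ, z.re * g ω / (z.re ^ 2 + (ω - z.im) ^ 2)) ∧
      (∫ ω : ℝ, z.re * g ω / (z.re ^ 2 + (ω - z.im) ^ 2)) ≤ Real.pi * C := by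
    intro z hz
    have hint := integrable_div_sub_I_mul hg hz
    have hre : ∀ ω : ℝ, ((g ω : ℂ) / (z - Complex.I * ω)).re =
        z.re * g ω / (z.re ^ 2 + (ω - z.im) ^ 2) := fun ω => re_ofReal_div_sub_I_mul _ ω z
    constructor
    · simp_rw [← hre]
      exact (integral_re hint).symm
    · rw [← integral_poissonKernel hz z.im, ← integral_mul_const]
      refine integral_mono_ae ?_ ((integrable_poissonKernel hz z.im).mul_const C) ?_
      · simp_rw [← hre]
        exact hint.re
      · filter_upwards [hbound] with ω hω
        rw [mul_div_right_comm]
        exact mul_le_mul_of_nonneg_left hω (by positivity)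
  refine ⟨hpoisson, ?_⟩
  rintro K hK hKC ⟨z, hz, hD⟩
  obtain ⟨heq, hle⟩ := hpoisson z hz
  have hre : (2 / (K : ℂ)).re = 2 / K := by
    rw [← Complex.ofReal_ofNat, ← Complex.ofReal_div, Complex.ofReal_re]
  rw [← heq, hD, hre, div_le_iff₀ hK] at hle
  rw [lt_div_iff₀ (by positivity)] at hKC
  linarith
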